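/- arXiv:2210.08683 — 2 statements merged into one kernel-verified Lean document; each statement's English description precedes it below -/
import Mathlib

section
/- Let a : ℕ → ℂ satisfy ∑_{n=0}^∞ η_n |a_n|² < ∞ and let f(z) = ∑_{n=0}^∞ a_n zⁿ. Then for every w ∈ ℂ the reproducing property holds: (1/π) ∫_ℂ f(z) · E(conj(z)·w) · (1+|z|²)^{-2} e^{-|z|²} dλ(z) = f(w), where E(u) = ∑_{n=0}^∞ uⁿ/η_n. -/
open MeasureTheory

/-- The moment sequence of the Hörmander-Fock space. -/
noncomputable def eta (n : ℕ) : ℝ :=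
  ∫ t in Set.Ioi (0 : ℝ), t ^ n / (1 + t) ^ 2 * Real.exp (-t)

/-- The special entire function `E(u) = ∑ uⁿ/ηₙ`. -/
noncomputable def Efun (u : ℂ) : ℂ := ∑' n : ℕ, u ^ n / (eta n : ℂ)

open scoped ComplexConjugate

lemma integrableOn_pow_mul_exp_neg_mul {b : ℝ} (hb : 0 < b) (n : ℕ) :
    IntegrableOn (fun t : ℝ => t ^ n * Real.exp (-(b * t))) (Set.Ioi 0) := by
  have h := integrableOn_rpow_mul_exp_neg_mul_rpow (p := 1) (s := n) (b := b)
    (by have : (0 : ℝ) ≤ n := n.cast_nonneg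
        linarith) one_pos hb
  simpa [Real.rpow_natCast] using h

lemma integral_pow_mul_exp_neg_mul {b : ℝ} (hb : 0 < b) (n : ℕ) :
    ∫ t in Set.Ioi (0 : ℝ), t ^ n * Real.exp (-(b * t)) = n.factorial / b ^ (n + 1) := by
  have h := Real.integral_rpow_mul_exp_neg_mul_Ioi (a := (n : ℝ) + 1) (r := b) (by positivity) hb
  rw [Real.Gamma_nat_eq_factorial] at h
  simp only [add_sub_cancel_right, Real.rpow_natCast] at h
  rw [h, ← Nat.cast_succ, Real.rpow_natCast, one_div, inv_pow]
  field_simp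

lemma one_add_sq_le_exp {t : ℝ} (ht : 0 ≤ t) : (1 + t) ^ 2 ≤ 64 * Real.exp (t / 4) := by
  have h1 : 1 + t ≤ 8 * Real.exp (t / 8) := by
    have := Real.add_one_le_exp (t / 8)
    linarith
  calc (1 + t) ^ 2 ≤ (8 * Real.exp (t / 8)) ^ 2 := by gcongr
    _ = 64 * Real.exp (t / 4) := by
      rw [mul_pow, ← Real.exp_nat_mul]
      ring_nf

lemma integrableOn_eta_integrand (n : ℕ) :
    IntegrableOn (fun t : ℝ => t ^ n / (1 + t) ^ 2 * Real.exp (-t)) (Set.Ioi 0) := by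
  have h := integrableOn_pow_mul_exp_neg_mul one_pos n
  refine h.mono' ?_ ?_
  · exact Measurable.aestronglyMeasurable (by fun_prop)
  · filter_upwards [ae_restrict_mem measurableSet_Ioi] with t ht
    have ht : 0 < t := ht
    rw [Real.norm_of_nonneg (by positivity), one_mul]
    gcongr
    exact div_le_self (by positivity) (by nlinarith)

lemma eta_ge (n : ℕ) : n.factorial / (80 * (5 / 4 : ℝ) ^ n) ≤ eta n := by
  have h : ∫ t in Set.Ioi (0 : ℝ), (1 / 64) * (t ^ n * Real.exp (-(5 / 4 * t))) ≤ eta n := by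
    refine setIntegral_mono_on ((integrableOn_pow_mul_exp_neg_mul (by norm_num) n).const_mul _)
      (integrableOn_eta_integrand n) measurableSet_Ioi fun t ht => ?_
    have ht : 0 < t := ht
    have h1 := one_add_sq_le_exp ht.le
    have h2 : Real.exp (-(5 / 4 * t)) * Real.exp (t / 4) = Real.exp (-t) := by
      rw [← Real.exp_add]
      ring_nf
    rw [div_mul_eq_mul_div (t ^ n), le_div_iff₀ (by positivity), ← h2]
    calc 1 / 64 * (t ^ n * Real.exp (-(5 / 4 * t))) * (1 + t) ^ 2
        ≤ 1 / 64 * (t ^ n * Real.exp (-(5 / 4 * t))) * (64 * Real.exp (t / 4)) := by gcongr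
      _ = _ := by ring
  rw [integral_const_mul, integral_pow_mul_exp_neg_mul (by norm_num)] at h
  refine le_trans (le_of_eq ?_) h
  rw [pow_succ]
  field_simp
  norm_num

lemma eta_pos (n : ℕ) : 0 < eta n :=
  lt_of_lt_of_le (by positivity) (eta_ge n)

lemma inv_eta_le (n : ℕ) : (eta n)⁻¹ ≤ 80 * (5 / 4 : ℝ) ^ n / n.factorial := by
  rw [← inv_div]
  exact inv_anti₀ (by positivity) (eta_ge n)

lemma pow_div_eta_le {s : ℝ} (hs : 0 ≤ s) (n : ℕ) :
    s ^ n / eta n ≤ 80 * ((5 / 4 * s) ^ n / n.factorial) := by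
  rw [div_eq_mul_inv]
  calc s ^ n * (eta n)⁻¹ ≤ s ^ n * (80 * (5 / 4 : ℝ) ^ n / n.factorial) := by
        gcongr
        exact inv_eta_le n
    _ = _ := by
        rw [mul_pow]
        ring

lemma hasSum_pow_div_factorial (s : ℝ) :
    HasSum (fun n : ℕ => s ^ n / n.factorial) (Real.exp s) := by
  rw [Real.exp_eq_exp_ℝ]
  exact NormedSpace.expSeries_div_hasSum_exp s

lemma summable_pow_div_eta {s : ℝ} (hs : 0 ≤ s) : Summable fun n : ℕ => s ^ n / eta n :=
  Summable.of_nonneg_of_le (fun n => div_nonneg (pow_nonneg hs n) (eta_pos n).le)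
    (pow_div_eta_le hs) ((hasSum_pow_div_factorial (5 / 4 * s)).summable.mul_left 80)

lemma tsum_pow_div_eta_le {s : ℝ} (hs : 0 ≤ s) :
    ∑' n : ℕ, s ^ n / eta n ≤ 80 * Real.exp (5 / 4 * s) := by
  have h := (hasSum_pow_div_factorial (5 / 4 * s)).mul_left 80
  rw [← h.tsum_eq]
  exact (summable_pow_div_eta hs).tsum_le_tsum (pow_div_eta_le hs) h.summable

lemma norm_pow_div_eta (u : ℂ) (n : ℕ) : ‖u ^ n / (eta n : ℂ)‖ = ‖u‖ ^ n / eta n := by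
  rw [norm_div, norm_pow, Complex.norm_real, Real.norm_of_nonneg (eta_pos n).le]

lemma summable_norm_pow_div_eta (u : ℂ) : Summable fun n : ℕ => ‖u ^ n / (eta n : ℂ)‖ := by
  simpa only [norm_pow_div_eta] using summable_pow_div_eta (norm_nonneg u)

/-- Coefficientwise growth estimate for functions in the Hörmander-Fock space. -/
lemma norm_mul_pow_le (c : ℂ) (r : ℝ) (n : ℕ) :
    ‖c‖ * r ^ n ≤ Real.exp (5 / 8 * r ^ 2) *
      ((eta n * ‖c‖ ^ 2 + Real.exp (-(5 / 4 * r ^ 2)) * ((r ^ 2) ^ n / eta n)) / 2) := by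
  have hη := eta_pos n
  set s := √(eta n) with hs
  have hs0 : 0 < s := Real.sqrt_pos.2 hη
  have hsq : eta n = s ^ 2 := (Real.sq_sqrt hη.le).symm
  set e := Real.exp (5 / 8 * r ^ 2) with he
  have he0 : 0 < e := Real.exp_pos _
  have h1 : Real.exp (-(5 / 4 * r ^ 2)) = (e ^ 2)⁻¹ := by
    rw [he, ← Real.exp_nat_mul, ← Real.exp_neg]
    ring_nf
  rw [h1, hsq, ← pow_mul, mul_comm 2 n, pow_mul]
  have key : e * ((s ^ 2 * ‖c‖ ^ 2 + (e ^ 2)⁻¹ * ((r ^ n) ^ 2 / s ^ 2)) / 2) - ‖c‖ * r ^ n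
      = e / 2 * (s * ‖c‖ - e⁻¹ * (r ^ n / s)) ^ 2 := by
    field_simp
    ring
  have : 0 ≤ e / 2 * (s * ‖c‖ - e⁻¹ * (r ^ n / s)) ^ 2 := by positivity
  linarith

lemma summable_norm_mul_pow {a : ℕ → ℂ} (ha : Summable fun n : ℕ => eta n * ‖a n‖ ^ 2)
    {r : ℝ} (hr : 0 ≤ r) : Summable fun n : ℕ => ‖a n‖ * r ^ n :=
  Summable.of_nonneg_of_le (fun n => by positivity) (fun n => norm_mul_pow_le (a n) r n)
    (((ha.add ((summable_pow_div_eta (sq_nonneg r)).mul_left _)).div_const 2).mul_left _)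

lemma tsum_norm_mul_pow_le {a : ℕ → ℂ} (ha : Summable fun n : ℕ => eta n * ‖a n‖ ^ 2)
    {r : ℝ} (hr : 0 ≤ r) :
    ∑' n : ℕ, ‖a n‖ * r ^ n ≤
      ((∑' n : ℕ, eta n * ‖a n‖ ^ 2) + 80) / 2 * Real.exp (5 / 8 * r ^ 2) := by
  have hs := summable_pow_div_eta (sq_nonneg r)
  refine ((summable_norm_mul_pow ha hr).tsum_le_tsum (fun n => norm_mul_pow_le (a n) r n)
    (((ha.add (hs.mul_left _)).div_const 2).mul_left _)).trans ?_
  rw [tsum_mul_left, tsum_div_const, ha.tsum_add (hs.mul_left _), tsum_mul_left, mul_comm]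
  gcongr
  calc Real.exp (-(5 / 4 * r ^ 2)) * ∑' n : ℕ, (r ^ 2) ^ n / eta n
      ≤ Real.exp (-(5 / 4 * r ^ 2)) * (80 * Real.exp (5 / 4 * r ^ 2)) := by
        gcongr
        exact tsum_pow_div_eta_le (sq_nonneg r)
    _ = 80 := by
        rw [mul_left_comm, ← Real.exp_add]
        simp

/-- The density of the Hörmander-Fock measure. -/
noncomputable def hfWeight (r : ℝ) : ℝ := ((1 + r ^ 2) ^ 2)⁻¹ * Real.exp (-r ^ 2)

lemma hfWeight_nonneg (r : ℝ) : 0 ≤ hfWeight r := by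
  unfold hfWeight
  positivity

lemma hfWeight_le (r : ℝ) : hfWeight r ≤ Real.exp (-r ^ 2) :=
  mul_le_of_le_one_left (Real.exp_pos _).le
    (inv_le_one_of_one_le₀ (by nlinarith [sq_nonneg r]))

lemma continuous_hfWeight : Continuous hfWeight := by
  unfold hfWeight
  exact Continuous.mul (Continuous.inv₀ (by fun_prop) fun r => by positivity) (by fun_prop)

lemma integral_exp_int_mul_I (k : ℤ) :
    ∫ θ in Set.Ioo (-Real.pi) Real.pi, Complex.exp (k * Complex.I * θ) =
      if k = 0 then 2 * (Real.pi : ℂ) else 0 := by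
  rw [← integral_Ioc_eq_integral_Ioo, ← intervalIntegral.integral_of_le (by linarith [Real.pi_pos])]
  split_ifs with hk
  · simp [hk]
    ring
  · have hc : (k : ℂ) * Complex.I ≠ 0 := by simp [hk]
    rw [integral_exp_mul_complex hc, div_eq_zero_iff]
    left
    rw [sub_eq_zero, Complex.exp_eq_exp_iff_exists_int]
    exact ⟨k, by push_cast; ring⟩

lemma integral_radial_moment (n : ℕ) :
    ∫ r in Set.Ioi (0 : ℝ), r * (r ^ n * r ^ n * hfWeight r) = eta n / 2 := by
  have h := integral_comp_rpow_Ioi_of_pos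
    (g := fun t : ℝ => t ^ n / (1 + t) ^ 2 * Real.exp (-t)) (p := 2) two_pos
  rw [eta, ← h, eq_div_iff two_ne_zero, ← integral_mul_const]
  congr 1 with r
  have h1 : (2 : ℝ) - 1 = 1 := by norm_num
  rw [h1, Real.rpow_one, Real.rpow_two, hfWeight, smul_eq_mul, ← pow_add, ← pow_mul, two_mul n]
  ring

/-- Monomials are orthogonal in the Hörmander-Fock space, with squared norm `π ηₙ`. -/
lemma integral_pow_mul_conj_pow_mul_hfWeight (n m : ℕ) :
    ∫ z : ℂ, z ^ n * conj z ^ m * (hfWeight ‖z‖ : ℂ) =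
      if n = m then (Real.pi : ℂ) * eta n else 0 := by
  rw [← Complex.integral_comp_polarCoord_symm, polarCoord_target]
  have h : ∀ p ∈ Set.Ioi (0 : ℝ) ×ˢ Set.Ioo (-Real.pi) Real.pi,
      p.1 • (Complex.polarCoord.symm p ^ n * conj (Complex.polarCoord.symm p) ^ m *
        (hfWeight ‖Complex.polarCoord.symm p‖ : ℂ)) =
      ((p.1 * (p.1 ^ n * p.1 ^ m * hfWeight p.1) : ℝ) : ℂ) *
        Complex.exp (((n : ℤ) - (m : ℤ) : ℤ) * Complex.I * p.2) := by
    rintro ⟨r, θ⟩ ⟨hr, -⟩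
    have hr : 0 < r := hr
    have hz : Complex.polarCoord.symm (r, θ) = r * Complex.exp (θ * Complex.I) := by
      rw [Complex.polarCoord_symm_apply, Complex.exp_mul_I]
      simp
    have hc : conj (Complex.exp (θ * Complex.I)) = Complex.exp (-(θ * Complex.I)) := by
      rw [← Complex.exp_conj]
      simp
    have he : Complex.exp (((n : ℤ) - (m : ℤ) : ℤ) * Complex.I * θ) =
        Complex.exp (θ * Complex.I) ^ n * Complex.exp (-(θ * Complex.I)) ^ m := by
      rw [← Complex.exp_nat_mul, ← Complex.exp_nat_mul, ← Complex.exp_add]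
      push_cast
      ring_nf
    simp only [hz, map_mul, hc, Complex.conj_ofReal, he, norm_mul, Complex.norm_real,
      Complex.norm_exp_ofReal_mul_I, mul_one, Real.norm_of_nonneg hr.le, Complex.real_smul]
    push_cast
    ring
  rw [setIntegral_congr_fun (measurableSet_Ioi.prod measurableSet_Ioo) h, Measure.volume_eq_prod,
    setIntegral_prod_mul (fun r : ℝ => ((r * (r ^ n * r ^ m * hfWeight r) : ℝ) : ℂ))
      (fun θ : ℝ => Complex.exp (((n : ℤ) - (m : ℤ) : ℤ) * Complex.I * θ)),
    integral_exp_int_mul_I]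
  by_cases hnm : n = m
  · subst hnm
    rw [integral_complex_ofReal, integral_radial_moment]
    simp
    ring
  · have : (n : ℤ) - m ≠ 0 := by omega
    simp [hnm, this]

lemma integrable_exp_neg_norm_sq_div_four :
    Integrable fun z : ℂ => Real.exp (-(1 / 4) * ‖z‖ ^ 2) := by
  have h := (GaussianFourier.integrable_cexp_neg_mul_sq_norm_add (b := 1 / 4) (V := ℂ)
    (by norm_num) 0 0).norm
  refine h.congr (Filter.Eventually.of_forall fun z => ?_)
  have : (-(1 / 4 : ℂ) * ‖z‖ ^ 2) = ((-(1 / 4) * ‖z‖ ^ 2 : ℝ) : ℂ) := by push_cast; ring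
  simp only [zero_mul, add_zero, this, Complex.norm_exp_ofReal]

lemma growth_mul_hfWeight_le {r s : ℝ} :
    Real.exp (5 / 8 * r ^ 2) * Real.exp (5 / 4 * (r * s)) * hfWeight r ≤
      Real.exp (25 / 8 * s ^ 2) * Real.exp (-(1 / 4) * r ^ 2) := by
  calc Real.exp (5 / 8 * r ^ 2) * Real.exp (5 / 4 * (r * s)) * hfWeight r
      ≤ Real.exp (5 / 8 * r ^ 2) * Real.exp (5 / 4 * (r * s)) * Real.exp (-r ^ 2) := by
        gcongr
        exact hfWeight_le r
    _ ≤ _ := by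
        rw [← Real.exp_add, ← Real.exp_add, ← Real.exp_add]
        refine Real.exp_le_exp.2 ?_
        nlinarith [sq_nonneg (r - 5 * s)]

theorem stmt_13 (a : ℕ → ℂ) (ha : Summable fun n : ℕ => eta n * ‖a n‖ ^ 2)
    (f : ℂ → ℂ) (hf : ∀ z : ℂ, HasSum (fun n : ℕ => a n * z ^ n) (f z)) (w : ℂ) :
    (1 / (Real.pi : ℂ)) *
        (∫ z : ℂ, f z * Efun ((starRingEnd ℂ) z * w) *
          ((((1 + ‖z‖ ^ 2) ^ 2)⁻¹ * Real.exp (-‖z‖ ^ 2) : ℝ) : ℂ)) = f w := by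
  change (1 / (Real.pi : ℂ)) *
    (∫ z : ℂ, f z * Efun (conj z * w) * (hfWeight ‖z‖ : ℂ)) = f w
  have hcw : Continuous fun z : ℂ => hfWeight ‖z‖ := continuous_hfWeight.comp continuous_norm
  let F : ℕ × ℕ → ℂ → ℂ := fun p z =>
    (a p.1 * z ^ p.1) * ((conj z * w) ^ p.2 / (eta p.2 : ℂ)) * (hfWeight ‖z‖ : ℂ)
  let B : ℕ × ℕ → ℂ → ℝ := fun p z =>
    (‖a p.1‖ * ‖z‖ ^ p.1) * ((‖z‖ * ‖w‖) ^ p.2 / eta p.2) * hfWeight ‖z‖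
  have hBnn : ∀ p z, 0 ≤ B p z := fun p z =>
    mul_nonneg (mul_nonneg (by positivity) (div_nonneg (by positivity) (eta_pos _).le))
      (hfWeight_nonneg _)
  have hA : ∀ z : ℂ, Summable fun n => ‖‖a n‖ * ‖z‖ ^ n‖ := fun z =>
    (summable_norm_mul_pow ha (norm_nonneg z)).norm
  have hE : ∀ z : ℂ, Summable fun n => ‖(‖z‖ * ‖w‖) ^ n / eta n‖ := fun z =>
    (summable_pow_div_eta (mul_nonneg (norm_nonneg z) (norm_nonneg w))).norm
  have hBsum : ∀ z, Summable fun p => B p z := fun z =>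
    (summable_mul_of_summable_norm (hA z) (hE z)).mul_right _
  have hBle : ∀ z, ∑' p, B p z ≤ ((∑' n : ℕ, eta n * ‖a n‖ ^ 2) + 80) / 2 * 80 *
      Real.exp (25 / 8 * ‖w‖ ^ 2) * Real.exp (-(1 / 4) * ‖z‖ ^ 2) := by
    intro z
    have hS : 0 ≤ ∑' n : ℕ, eta n * ‖a n‖ ^ 2 :=
      tsum_nonneg fun n => mul_nonneg (eta_pos n).le (by positivity)
    have hzw : 0 ≤ ‖z‖ * ‖w‖ := by positivity
    simp only [B]
    rw [tsum_mul_right, ← tsum_mul_tsum_of_summable_norm (hA z) (hE z)]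
    calc _ ≤ (((∑' n : ℕ, eta n * ‖a n‖ ^ 2) + 80) / 2 * Real.exp (5 / 8 * ‖z‖ ^ 2)) *
          (80 * Real.exp (5 / 4 * (‖z‖ * ‖w‖))) * hfWeight ‖z‖ := by
          refine mul_le_mul_of_nonneg_right (mul_le_mul (tsum_norm_mul_pow_le ha (norm_nonneg z))
            (tsum_pow_div_eta_le hzw) (tsum_nonneg fun n => div_nonneg (by positivity)
              (eta_pos n).le) (by positivity)) (hfWeight_nonneg _)
      _ = ((∑' n : ℕ, eta n * ‖a n‖ ^ 2) + 80) / 2 * 80 * (Real.exp (5 / 8 * ‖z‖ ^ 2) *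
          Real.exp (5 / 4 * (‖z‖ * ‖w‖)) * hfWeight ‖z‖) := by ring
      _ ≤ _ := by
          rw [mul_assoc _ (Real.exp _) (Real.exp _)]
          exact mul_le_mul_of_nonneg_left growth_mul_hfWeight_le (by positivity)
  have hBint : Integrable fun z => ∑' p, B p z := by
    refine (integrable_exp_neg_norm_sq_div_four.const_mul
      (((∑' n : ℕ, eta n * ‖a n‖ ^ 2) + 80) / 2 * 80 * Real.exp (25 / 8 * ‖w‖ ^ 2))).mono' ?_
      (Filter.Eventually.of_forall fun z => ?_)
    · refine aestronglyMeasurable_of_tendsto_ae Filter.atTop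
        (f := fun (s : Finset (ℕ × ℕ)) z => ∑ p ∈ s, B p z) (fun s => ?_)
        (Filter.Eventually.of_forall fun z => (hBsum z).hasSum)
      exact Continuous.aestronglyMeasurable (by fun_prop)
    · rw [Real.norm_of_nonneg (tsum_nonneg fun p => hBnn p z)]
      exact hBle z
  have hFsum : ∀ z, HasSum (fun p => F p z) (f z * Efun (conj z * w) * (hfWeight ‖z‖ : ℂ)) := by
    intro z
    have hu := summable_norm_pow_div_eta (conj z * w)
    have hEu : HasSum (fun m : ℕ => (conj z * w) ^ m / (eta m : ℂ)) (Efun (conj z * w)) :=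
      hu.of_norm.hasSum
    have hfz : Summable fun n : ℕ => ‖a n * z ^ n‖ := (hf z).summable.norm
    have hs := summable_mul_of_summable_norm hfz hu
    exact ((hf z).mul hEu hs).mul_right (hfWeight ‖z‖ : ℂ)
  have hmain := hasSum_integral_of_dominated_convergence (μ := volume) (F := F) B
    (fun p => Continuous.aestronglyMeasurable (by fun_prop))
    (fun p => Filter.Eventually.of_forall fun z => by
      simp only [F, B]
      rw [norm_mul, norm_mul, norm_mul, norm_pow_div_eta, norm_mul, norm_pow, RCLike.norm_conj,
        Complex.norm_real, Real.norm_of_nonneg (hfWeight_nonneg _)])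
    (Filter.Eventually.of_forall hBsum) hBint (Filter.Eventually.of_forall hFsum)
  have hFint : ∀ p : ℕ × ℕ, ∫ z, F p z =
      if p.1 = p.2 then (Real.pi : ℂ) * (a p.1 * w ^ p.1) else 0 := by
    rintro ⟨n, m⟩
    have h1 : ∀ z, F (n, m) z =
        (a n * (w ^ m / (eta m : ℂ))) * (z ^ n * conj z ^ m * (hfWeight ‖z‖ : ℂ)) := by
      intro z
      simp only [F, mul_pow]
      ring
    simp only [h1]
    rw [integral_const_mul, integral_pow_mul_conj_pow_mul_hfWeight]
    split_ifs with hnm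
    · subst hnm
      have : (eta n : ℂ) ≠ 0 := by exact_mod_cast (eta_pos n).ne'
      field_simp
    · simp
  simp only [hFint] at hmain
  have hdiag : Function.Injective fun n : ℕ => (n, n) := fun i j h => (Prod.ext_iff.1 h).1
  rw [← hdiag.hasSum_iff] at hmain
  · have hpi : (Real.pi : ℂ) ≠ 0 := by exact_mod_cast Real.pi_ne_zero
    have h2 := hmain.unique (by simpa [Function.comp_def] using (hf w).mul_left (Real.pi : ℂ))
    rw [h2]
    field_simp
  · rintro ⟨n, m⟩ hp
    have : n ≠ m := fun h => hp ⟨n, by simp [h]⟩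
    simp [this]
end

section
/- For every integer n ≥ 1 and every real a with -1 < a < 1, one has ∑_{k=0}^∞ (-a)^k/(k+n) = ∫₀^∞ e^{-at} E_n(t) dt, where E_n(t) := ∫₁^∞ e^{-ts} s^{-n} ds for t > 0. -/
open MeasureTheory

/-- The exponential integral function `Eₙ(t) = ∫₁^∞ e^{-ts} s^{-n} ds` for `t > 0`. -/
noncomputable def expInt (n : ℕ) (t : ℝ) : ℝ :=
  ∫ s in Set.Ioi (1 : ℝ), Real.exp (-(t * s)) / s ^ n

theorem integrableOn_Ioi_one_inv_pow {m : ℕ} (hm : 1 ≤ m) :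
    IntegrableOn (fun s : ℝ => (s ^ (m + 1))⁻¹) (Set.Ioi 1) := by
  have hm' : (1 : ℝ) ≤ m := by exact_mod_cast hm
  refine (integrableOn_Ioi_rpow_of_lt (a := -((m + 1 : ℕ) : ℝ)) (by push_cast; linarith)
    one_pos).congr_fun (fun s hs => ?_) measurableSet_Ioi
  have hs0 : (0 : ℝ) < s := one_pos.trans hs
  simp only [Real.rpow_neg hs0.le, Real.rpow_natCast]

theorem integral_Ioi_one_inv_pow {m : ℕ} (hm : 1 ≤ m) :
    ∫ s in Set.Ioi (1 : ℝ), (s ^ (m + 1))⁻¹ = (m : ℝ)⁻¹ := by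
  have hm' : (1 : ℝ) ≤ m := by exact_mod_cast hm
  have h := integral_Ioi_rpow_of_lt (a := -((m + 1 : ℕ) : ℝ)) (by push_cast; linarith) one_pos
  rw [setIntegral_congr_fun (g := fun s : ℝ => s ^ (-((m + 1 : ℕ) : ℝ))) measurableSet_Ioi, h]
  · rw [Real.one_rpow]
    push_cast
    rw [show -((m : ℝ) + 1) + 1 = -m by ring, neg_div_neg_eq, one_div]
  · intro s hs
    have hs0 : (0 : ℝ) < s := one_pos.trans hs
    simp only [Real.rpow_neg hs0.le, Real.rpow_natCast]

theorem exp_neg_mul_mul_exp_div_pow (n : ℕ) (a s t : ℝ) :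
    Real.exp (-(a * t)) * (Real.exp (-(t * s)) / s ^ n) =
      Real.exp (-(s + a) * t) * (s ^ n)⁻¹ := by
  rw [div_eq_mul_inv, ← mul_assoc, ← Real.exp_add]
  ring_nf

theorem integral_Ioi_zero_exp_mul_exp_div_pow (n : ℕ) {a s : ℝ} (h : 0 < s + a) :
    ∫ t in Set.Ioi (0 : ℝ), Real.exp (-(a * t)) * (Real.exp (-(t * s)) / s ^ n) =
      ((s + a) * s ^ n)⁻¹ := by
  simp_rw [exp_neg_mul_mul_exp_div_pow]
  rw [integral_mul_const, integral_exp_mul_Ioi (by linarith), mul_zero, Real.exp_zero,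
    neg_div_neg_eq, one_div, mul_inv]

theorem integrableOn_Ioi_zero_exp_mul_exp_div_pow (n : ℕ) {a s : ℝ} (h : 0 < s + a) :
    IntegrableOn (fun t : ℝ => Real.exp (-(a * t)) * (Real.exp (-(t * s)) / s ^ n))
      (Set.Ioi 0) := by
  simp_rw [exp_neg_mul_mul_exp_div_pow]
  exact (integrableOn_exp_mul_Ioi (by linarith) 0).mul_const _

theorem integrableOn_Ioi_one_inv_add_mul_pow {n : ℕ} (hn : 1 ≤ n) {a : ℝ} (ha : |a| < 1) :
    IntegrableOn (fun s : ℝ => ((s + a) * s ^ n)⁻¹) (Set.Ioi 1) := by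
  refine Integrable.mono' ((integrableOn_Ioi_one_inv_pow hn).const_mul (1 - |a|)⁻¹)
    (by fun_prop) ?_
  refine (ae_restrict_iff' measurableSet_Ioi).2 (.of_forall fun s (hs : 1 < s) => ?_)
  have hs0 : (0 : ℝ) < s := one_pos.trans hs
  have hc : 0 < 1 - |a| := by linarith
  have hsa : (1 - |a|) * s ≤ s + a := by nlinarith [neg_abs_le a, abs_nonneg a]
  have hpos : 0 < (1 - |a|) * s := mul_pos hc hs0
  rw [Real.norm_of_nonneg (inv_nonneg.2 (mul_pos (hpos.trans_le hsa) (pow_pos hs0 n)).le), ← mul_inv, pow_succ']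
  refine inv_anti₀ (by positivity) ?_
  rw [← mul_assoc]
  gcongr

theorem integrable_prod_exp_mul_exp_div_pow {n : ℕ} (hn : 1 ≤ n) {a : ℝ} (ha : |a| < 1) :
    Integrable
      (Function.uncurry fun t s : ℝ => Real.exp (-(a * t)) * (Real.exp (-(t * s)) / s ^ n))
      ((volume.restrict (Set.Ioi (0 : ℝ))).prod (volume.restrict (Set.Ioi (1 : ℝ)))) := by
  have hsa {s : ℝ} (hs : s ∈ Set.Ioi (1 : ℝ)) : 0 < s + a := by
    have : 1 < s := hs
    linarith [neg_abs_le a]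
  rw [integrable_prod_iff' (by unfold Function.uncurry; fun_prop)]
  refine ⟨(ae_restrict_iff' measurableSet_Ioi).2 (.of_forall fun s hs =>
    integrableOn_Ioi_zero_exp_mul_exp_div_pow n (hsa hs)), ?_⟩
  refine (integrableOn_Ioi_one_inv_add_mul_pow hn ha).congr_fun (fun s hs => ?_) measurableSet_Ioi
  have hs0 : (0 : ℝ) < s := one_pos.trans hs
  refine (integral_Ioi_zero_exp_mul_exp_div_pow n (hsa hs)).symm.trans ?_
  refine integral_congr_ae (.of_forall fun t => ?_)
  exact (Real.norm_of_nonneg (by simp only; positivity)).symm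

theorem hasSum_integral_Ioi_one_inv_add_mul_pow {n : ℕ} (hn : 1 ≤ n) {a : ℝ} (ha : |a| < 1) :
    HasSum (fun k : ℕ => (-a) ^ k / ((k : ℝ) + n))
      (∫ s in Set.Ioi (1 : ℝ), ((s + a) * s ^ n)⁻¹) := by
  have hkn (k : ℕ) : 1 ≤ k + n := by omega
  have hint (c : ℝ) (k : ℕ) :
      ∫ s in Set.Ioi (1 : ℝ), c ^ k * (s ^ (k + n + 1))⁻¹ = c ^ k / ((k : ℝ) + n) := by
    rw [integral_const_mul, integral_Ioi_one_inv_pow (hkn k), Nat.cast_add, div_eq_mul_inv]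
  have hnorm (k : ℕ) : ∫ s in Set.Ioi (1 : ℝ), ‖(-a) ^ k * (s ^ (k + n + 1))⁻¹‖ =
      |a| ^ k / ((k : ℝ) + n) := by
    rw [← hint]
    refine setIntegral_congr_fun measurableSet_Ioi fun s hs => ?_
    have hs0 : (0 : ℝ) < s := one_pos.trans hs
    simp only [norm_mul, norm_pow, norm_neg, norm_inv, Real.norm_eq_abs, abs_of_pos hs0]
  have hsum : Summable fun k : ℕ =>
      ∫ s in Set.Ioi (1 : ℝ), ‖(-a) ^ k * (s ^ (k + n + 1))⁻¹‖ := by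
    simp_rw [hnorm]
    refine (summable_geometric_of_lt_one (abs_nonneg a) ha).of_nonneg_of_le
      (fun k => by positivity) fun k => div_le_self (by positivity) ?_
    exact_mod_cast hkn k
  have h := hasSum_integral_of_summable_integral_norm
    (F := fun (k : ℕ) (s : ℝ) => (-a) ^ k * (s ^ (k + n + 1))⁻¹)
    (fun k => (integrableOn_Ioi_one_inv_pow (hkn k)).const_mul ((-a) ^ k)) hsum
  simp_rw [hint] at h
  suffices heq : Set.EqOn (fun s : ℝ => ((s + a) * s ^ n)⁻¹)
      (fun s => ∑' k : ℕ, (-a) ^ k * (s ^ (k + n + 1))⁻¹) (Set.Ioi 1) by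
    rwa [setIntegral_congr_fun measurableSet_Ioi heq]
  intro s (hs : 1 < s)
  have hs0 : (0 : ℝ) < s := one_pos.trans hs
  have hsa : 0 < s + a := by linarith [neg_abs_le a]
  have hr : |-a / s| < 1 := by
    rw [abs_div, abs_neg, abs_of_pos hs0, div_lt_one hs0]
    linarith
  have hterm (k : ℕ) : (-a) ^ k * (s ^ (k + n + 1))⁻¹ = (-a / s) ^ k * (s ^ (n + 1))⁻¹ := by
    rw [div_pow]
    field_simp
    ring
  have hden : 1 - -a / s = (s + a) / s := by
    field_simp
    ring
  simp_rw [hterm]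
  rw [tsum_mul_right, tsum_geometric_of_abs_lt_one hr, hden, pow_succ]
  field_simp

theorem stmt_18 (n : ℕ) (hn : 1 ≤ n) (a : ℝ) (ha1 : -1 < a) (ha2 : a < 1) :
    HasSum (fun k : ℕ => (-a) ^ k / ((k : ℝ) + n))
      (∫ t in Set.Ioi (0 : ℝ), Real.exp (-(a * t)) * expInt n t) := by
  have ha : |a| < 1 := abs_lt.2 ⟨ha1, ha2⟩
  simp_rw [expInt, ← integral_const_mul]
  rw [integral_integral_swap (integrable_prod_exp_mul_exp_div_pow hn ha),
    setIntegral_congr_fun measurableSet_Ioi fun s (hs : 1 < s) =>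
      integral_Ioi_zero_exp_mul_exp_div_pow n (by linarith : 0 < s + a)]
  exact hasSum_integral_Ioi_one_inv_add_mul_pow hn ha
end
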